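/- Let a ∈ ℂ with a ≠ 1, let m ≥ 3 be an integer, and let P ∈ ℂ[x,y] be a homogeneous polynomial of degree m satisfying equation (E) with parameters (a, b) = (a, a), and such that P(λ, 0) = 0 for all λ ∈ ℂ. Then P = 0. -/

import Mathlib

open MvPolynomial

/-- Evaluation of a bivariate polynomial at a pair of complex numbers. -/
noncomputable def ev2 (P : MvPolynomial (Fin 2) ℂ) (x y : ℂ) : ℂ :=
  MvPolynomial.eval ![x, y] P

/-- The chain rule for a bivariate polynomial along a curve. -/
theorem hasDerivAt_ev2 (P : MvPolynomial (Fin 2) ℂ) {f g : ℂ → ℂ} {df dg t : ℂ}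
    (hf : HasDerivAt f df t) (hg : HasDerivAt g dg t) :
    HasDerivAt (fun s => ev2 P (f s) (g s))
      (df * ev2 (pderiv 0 P) (f t) (g t) + dg * ev2 (pderiv 1 P) (f t) (g t)) t := by
  simp only [ev2]
  induction P using MvPolynomial.induction_on with
  | C c => simpa using hasDerivAt_const t c
  | add p q hp hq =>
    simp only [map_add]
    exact (hp.add hq).congr_deriv (by ring)
  | mul_X p i hp =>
    simp only [map_mul, eval_X, Derivation.leibniz, smul_eq_mul, map_add, pderiv_X]
    fin_cases i
    · exact (hp.mul hf).congr_deriv (by simp; ring)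
    · exact (hp.mul hg).congr_deriv (by simp; ring)

/-- Euler's identity for homogeneous bivariate polynomials. -/
theorem ev2_euler {P : MvPolynomial (Fin 2) ℂ} {m : ℕ} (hP : P.IsHomogeneous m) (x y : ℂ) :
    x * ev2 (pderiv 0 P) x y + y * ev2 (pderiv 1 P) x y = m * ev2 P x y := by
  have h := congrArg (eval ![x, y]) hP.sum_X_mul_pderiv
  simpa [ev2, Fin.sum_univ_two] using h

theorem stmt7 (a : ℂ) (ha : a ≠ 1) (m : ℕ) (hm : 3 ≤ m)
    (P : MvPolynomial (Fin 2) ℂ) (hhom : P.IsHomogeneous m)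
    (hE : ∀ l1 l2 l3 : ℂ,
      ((a - 1) * l1 - l2 - l3) * ev2 P l2 l3
        - (-l1 + (a - 1) * l2 - l3) * ev2 P l1 l3
        - (l1 - l2) * ev2 P (l1 + l2) l3
        - ((a - 1) * l1 - l3) * ev2 P l2 (l1 + l3)
        + ((a - 1) * l2 - l3) * ev2 P l1 (l2 + l3) = 0)
    (hP0 : ∀ lam : ℂ, ev2 P lam 0 = 0) :
    P = 0 := by
  have hsymm (x y : ℂ) : y * ev2 P x y = x * ev2 P y x := by
    have h := hE x y 0
    simp only [hP0, add_zero, sub_zero, mul_zero, zero_sub] at h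
    exact mul_left_cancel₀ (sub_ne_zero.mpr ha) (by linear_combination h)
  have hleft (y : ℂ) : ev2 P 0 y = 0 := by
    rcases eq_or_ne y 0 with rfl | hy
    · exact hP0 0
    · simpa [hy] using hsymm 0 y
  have hderiv (y : ℂ) : ev2 (pderiv 0 P) 0 y = 0 := by
    have hx := hasDerivAt_id' (0 : ℂ)
    have hD := hasDerivAt_ev2 P hx (hasDerivAt_const (0 : ℂ) y)
    rcases eq_or_ne y 0 with rfl | hy
    · simp only [hP0] at hD
      simpa using hD.unique (hasDerivAt_const _ _)
    · have hR := hx.mul (hasDerivAt_ev2 P (hasDerivAt_const (0 : ℂ) y) hx)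
      have hL := hD.const_mul y
      have hfun : (fun s => y * ev2 P s y) = (fun s => s) * fun s => ev2 P y s :=
        funext fun s => hsymm s y
      rw [hfun] at hL
      simpa [hP0, hy] using hL.unique hR
  have hzero (x y : ℂ) : ev2 P x y = 0 := by
    have ht := hasDerivAt_id' (0 : ℂ)
    have hc (z : ℂ) := hasDerivAt_const (0 : ℂ) z
    have hD := ((((((ht.const_mul (a - 1)).sub_const x).sub_const y).mul_const (ev2 P x y)).sub
      (((ht.neg.add_const ((a - 1) * x)).sub_const y).mul (hasDerivAt_ev2 P ht (hc y)))).sub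
      ((ht.sub_const x).mul (hasDerivAt_ev2 P (ht.add_const x) (hc y)))).sub
      (((ht.const_mul (a - 1)).sub_const y).mul (hasDerivAt_ev2 P (hc x) (ht.add_const y))) |>.add
      ((hasDerivAt_ev2 P ht (hc (x + y))).const_mul ((a - 1) * x - y))
    have h := (hD.congr_of_eventuallyEq (f₁ := fun _ => 0)
      (.of_forall fun t => (hE t x y).symm)).unique (hc 0)
    simp only [hleft, hderiv, zero_add] at h
    have hm1 : (m : ℂ) - 1 ≠ 0 := sub_ne_zero.mpr (by norm_cast; omega)
    refine (mul_eq_zero.mp ?_).resolve_left hm1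
    linear_combination h - ev2_euler hhom x y
  refine MvPolynomial.funext fun v => ?_
  have hv : v = ![v 0, v 1] := by ext i; fin_cases i <;> rfl
  rw [hv, map_zero]
  exact hzero _ _
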